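/- Fix an integer n ≥ 1 and let λ be an (n+1)-core with abacus parameters (a_1, …, a_{n+1}), where a_r(λ) = #{p ∈ B(λ) : p > 0, p ≡ r (mod n+1)} − #{p ≤ 0 : p ∉ B(λ), p ≡ r (mod n+1)}. Then wt_0(λ) = (1/2)·Σ_{s=1}^{n+1} a_s², and for every 1 ≤ r ≤ n, wt_r(λ) = (1/2)·Σ_{s=1}^{n+1} a_s² + Σ_{s=n+2−r}^{n+1} a_s. -/

import Mathlib

/-- A partition: a weakly decreasing sequence of nonnegative integers with finitely
many nonzero terms. `parts i` denotes `λ_{i+1}` (0-indexed). -/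
structure NatPartition where
  parts : ℕ → ℕ
  antitone : ∀ ⦃i j : ℕ⦄, i ≤ j → parts j ≤ parts i
  finite_support : ∃ N : ℕ, ∀ i : ℕ, N ≤ i → parts i = 0

namespace NatPartition

/-- The Young diagram `Y(λ) = {(i,j) : j < λ_{i+1}}`. -/
def diagram (l : NatPartition) : Set (ℕ × ℕ) := {c : ℕ × ℕ | c.2 < l.parts c.1}

/-- The bead set (Maya diagram) `B(λ) = {λ_i − i + 1 : i = 1, 2, …} ⊆ ℤ`. -/
def beadSet (l : NatPartition) : Set ℤ := Set.range fun i : ℕ => (l.parts i : ℤ) - (i : ℤ)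

/-- The total number of cells of the partition. -/
noncomputable def size (l : NatPartition) : ℕ := l.diagram.ncard

/-- `wt n r l` is the number of cells `(i,j)` of `l` with `i − j ≡ r (mod n+1)`. -/
noncomputable def wt (n : ℕ) (r : ℤ) (l : NatPartition) : ℕ :=
  {c : ℕ × ℕ | c ∈ l.diagram ∧ ((c.1 : ℤ) - (c.2 : ℤ)) ≡ r [ZMOD ((n : ℤ) + 1)]}.ncard

end NatPartition

/-- A subset `S ⊆ ℤ` is balanced if `S ∩ ℤ_{>0}` and `ℤ_{≤0} ∖ S` are finite of the
same cardinality. -/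
def IsBalanced (S : Set ℤ) : Prop :=
  (S ∩ {p : ℤ | 0 < p}).Finite ∧ ({p : ℤ | p ≤ 0} \ S).Finite ∧
    (S ∩ {p : ℤ | 0 < p}).ncard = ({p : ℤ | p ≤ 0} \ S).ncard

/-- Two cells share an edge. -/
def CellAdj (p q : ℕ × ℕ) : Prop :=
  (p.1 = q.1 ∧ (p.2 + 1 = q.2 ∨ q.2 + 1 = p.2)) ∨
  (p.2 = q.2 ∧ (p.1 + 1 = q.1 ∨ q.1 + 1 = p.1))

/-- A set of cells is connected through shared edges. -/
def CellConnected (S : Set (ℕ × ℕ)) : Prop :=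
  ∀ p ∈ S, ∀ q ∈ S,
    Relation.ReflTransGen (fun a b => a ∈ S ∧ b ∈ S ∧ CellAdj a b) p q

/-- The set of cells contains no 2×2 square. -/
def NoTwoByTwo (S : Set (ℕ × ℕ)) : Prop :=
  ¬ ∃ i j : ℕ, (i, j) ∈ S ∧ (i + 1, j) ∈ S ∧ (i, j + 1) ∈ S ∧ (i + 1, j + 1) ∈ S

/-- A border strip of length `m`: exactly `m` cells, edge-connected, no 2×2 square. -/
def IsBorderStrip (S : Set (ℕ × ℕ)) (m : ℕ) : Prop :=
  S.Finite ∧ S.ncard = m ∧ CellConnected S ∧ NoTwoByTwo S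

/-- `l` is an `(n+1)`-core: no border strip of length `n+1` can be removed from it. -/
def IsCore (n : ℕ) (l : NatPartition) : Prop :=
  ¬ ∃ m : NatPartition, m.diagram ⊆ l.diagram ∧
      IsBorderStrip (l.diagram \ m.diagram) (n + 1)

/-- A cell `c ∉ Y(l)` is addable if `Y(l) ∪ {c}` is again a Young diagram. -/
def Addable (l : NatPartition) (c : ℕ × ℕ) : Prop :=
  c ∉ l.diagram ∧ ∃ m : NatPartition, m.diagram = l.diagram ∪ {c}

/-- `l` is 0-generated: every addable cell has content `≡ 0 (mod n+1)`. -/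
def ZeroGenerated (n : ℕ) (l : NatPartition) : Prop :=
  ∀ c : ℕ × ℕ, Addable l c → ((c.1 : ℤ) - (c.2 : ℤ)) ≡ 0 [ZMOD ((n : ℤ) + 1)]

/-- The abacus parameter `a_r(λ)`: the number of positive beads congruent to `r`
minus the number of absent nonpositive positions congruent to `r` (mod `n+1`). -/
noncomputable def abacusParam (n : ℕ) (r : ℤ) (l : NatPartition) : ℤ :=
  ({p : ℤ | p ∈ l.beadSet ∧ 0 < p ∧ p ≡ r [ZMOD ((n : ℤ) + 1)]}.ncard : ℤ) -
  ({p : ℤ | p ≤ 0 ∧ p ∉ l.beadSet ∧ p ≡ r [ZMOD ((n : ℤ) + 1)]}.ncard : ℤ)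

open NatPartition in
theorem core_shift (n : ℕ) (l : NatPartition) (hcore : IsCore n l) (p : ℤ)
    (hp : p ∈ l.beadSet) : p - ((n : ℤ) + 1) ∈ l.beadSet := by
  by_contra hq
  obtain ⟨i, hi⟩ := hp
  simp only at hi
  obtain ⟨q, hqd⟩ : ∃ q : ℤ, q = p - ((n : ℤ) + 1) := ⟨_, rfl⟩
  rw [← hqd] at hq
  have hqn : ∀ k : ℕ, (l.parts k : ℤ) - k ≠ q := fun k hk => hq ⟨k, hk⟩
  apply hcore
  obtain ⟨M, hM⟩ := l.finite_support
  have hst : ∀ k, l.parts (k+1) ≤ l.parts k := fun k => l.antitone (Nat.le_succ k)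
  let mp : ℕ → ℕ := fun k => if k < i then l.parts k else
    (min (l.parts k : ℤ) (max (q + k) ((l.parts (k+1) : ℤ) - 1))).toNat
  have hle : ∀ k, mp k ≤ l.parts k := by
    intro k
    simp only [mp]
    split_ifs <;> omega
  let m : NatPartition :=
    { parts := mp
      antitone := by
        intro a b hab
        refine antitone_nat_of_succ_le ?_ hab
        intro k
        have h1 := hst k
        have h2 := hst (k+1)
        have h3 := hqn (k+1)
        simp only [mp]
        push_cast at *
        split_ifs <;> omega
      finite_support := ⟨M, fun k hk => by have := hle k; have := hM k hk; omega⟩ }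
  have hS : l.diagram \ m.diagram = {c : ℕ × ℕ | c.2 < l.parts c.1 ∧
      l.parts (c.1+1) ≤ c.2 + 1 ∧ q ≤ (c.2 : ℤ) - c.1 ∧ (c.2 : ℤ) - c.1 < p} := by
    ext ⟨k, c⟩
    simp only [Set.mem_diff, diagram, Set.mem_setOf_eq, m, mp]
    have h1 := hst k
    by_cases hk : k < i
    · have h2 : l.parts i ≤ l.parts (k+1) := l.antitone hk
      simp only [hk, if_true]
      constructor
      · rintro ⟨h, h'⟩; omega
      · rintro ⟨h, h', h3, h4⟩; omega
    · have h2 : l.parts k ≤ l.parts i := l.antitone (by omega)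
      simp only [hk, if_false]
      constructor
      · rintro ⟨h, h'⟩; omega
      · rintro ⟨h, h', h3, h4⟩; omega
  refine ⟨m, ?_, ?_⟩
  · intro c hc
    simp only [diagram, Set.mem_setOf_eq] at *
    exact lt_of_lt_of_le hc (hle _)
  rw [hS]
  set S := {c : ℕ × ℕ | c.2 < l.parts c.1 ∧
      l.parts (c.1+1) ≤ c.2 + 1 ∧ q ≤ (c.2 : ℤ) - c.1 ∧ (c.2 : ℤ) - c.1 < p} with hSd
  have hinj : Set.InjOn (fun c : ℕ × ℕ => (c.2 : ℤ) - c.1) S := by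
    rintro ⟨k, c⟩ ⟨h1, h2, -, -⟩ ⟨k', c'⟩ ⟨h1', h2', -, -⟩ h
    simp only at *
    have : k = k' := by
      rcases lt_trichotomy k k' with hk | hk | hk
      · have := l.antitone (show k + 1 ≤ k' from hk); omega
      · exact hk
      · have := l.antitone (show k' + 1 ≤ k from hk); omega
    subst this
    have : c = c' := by omega
    rw [this]
  have himg : (fun c : ℕ × ℕ => (c.2 : ℤ) - c.1) '' S = Set.Ico q p := by
    ext x
    constructor
    · rintro ⟨⟨k, c⟩, ⟨h1, h2, h3, h4⟩, rfl⟩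
      exact ⟨h3, h4⟩
    · rintro ⟨hx1, hx2⟩
      have hex : ∃ k : ℕ, (l.parts (k+1) : ℤ) - (k+1) ≤ x := by
        refine ⟨M + x.natAbs, ?_⟩
        rw [hM _ (by omega)]
        have := neg_abs_le x
        push_cast
        omega
      classical
      obtain ⟨k, hk, hmin⟩ : ∃ k : ℕ, ((l.parts (k+1) : ℤ) - (k+1) ≤ x) ∧
          ∀ j < k, ¬ ((l.parts (j+1) : ℤ) - (j+1) ≤ x) :=
        ⟨Nat.find hex, Nat.find_spec hex, fun j hj => Nat.find_min hex hj⟩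
      have hkx : x < (l.parts k : ℤ) - k := by
        rcases k with _ | k
        · have := l.antitone (Nat.zero_le i)
          push_cast
          omega
        · have := hmin k (Nat.lt_succ_self k)
          push_cast
          omega
      have hnn : 0 ≤ x + k := by
        by_contra hneg
        have h0 : l.parts (k+1) = 0 := by omega
        have h1 : l.parts (-q).toNat = 0 := by
          have := l.antitone (show k + 1 ≤ (-q).toNat by omega)
          omega
        apply hqn (-q).toNat
        rw [h1]
        omega
      refine ⟨(k, (x + k).toNat), ⟨?_, ?_, ?_, ?_⟩, ?_⟩ <;> simp only <;> omega
  have hfin : S.Finite := by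
    refine Set.Finite.of_finite_image ?_ hinj
    rw [himg]
    exact Set.finite_Ico q p
  refine ⟨hfin, ?_, ?_, ?_⟩
  · rw [← Set.ncard_image_of_injOn hinj, himg]
    rw [← Finset.coe_Ico, Set.ncard_coe_finset, Int.card_Ico]
    omega
  · have key : ∀ d : ℕ, ∀ a ∈ S, ∀ b ∈ S, (b.2 : ℤ) - b.1 = (a.2 : ℤ) - a.1 + d →
        Relation.ReflTransGen (fun a b => a ∈ S ∧ b ∈ S ∧ CellAdj a b) a b := by
      intro d
      induction d with
      | zero =>
        intro a ha b hb h
        have : b = a := hinj hb ha (by simpa using h)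
        rw [this]
      | succ d ih =>
        intro a ha b hb h
        have hmem : (b.2 : ℤ) - b.1 - 1 ∈ (fun c : ℕ × ℕ => (c.2 : ℤ) - c.1) '' S := by
          rw [himg]
          have h1 := ha.2.2.1
          have h2 := hb.2.2.2
          push_cast at h
          constructor <;> omega
        obtain ⟨c, hc, hcx⟩ := hmem
        simp only at hcx
        refine Relation.ReflTransGen.tail (ih a ha c hc (by push_cast at h; omega)) ⟨hc, hb, ?_⟩
        obtain ⟨k, x⟩ := c
        obtain ⟨k', x'⟩ := b
        obtain ⟨h1, h2, -, -⟩ := hc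
        obtain ⟨h1', h2', -, -⟩ := hb
        simp only [CellAdj] at *
        rcases lt_trichotomy k k' with hk | hk | hk
        · have := l.antitone (show k + 1 ≤ k' from hk); omega
        · left; omega
        · right
          have := l.antitone (show k' + 1 ≤ k from hk); omega
    have hsymm : Symmetric (fun a b => a ∈ S ∧ b ∈ S ∧ CellAdj a b) := by
      rintro a b ⟨h1, h2, h3⟩
      refine ⟨h2, h1, ?_⟩
      simp only [CellAdj] at *
      omega
    intro a ha b hb
    rcases le_total ((a.2 : ℤ) - a.1) ((b.2 : ℤ) - b.1) with h | h
    · exact key ((b.2 : ℤ) - b.1 - ((a.2 : ℤ) - a.1)).toNat a ha b hb (by omega)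
    · have := key ((a.2 : ℤ) - a.1 - ((b.2 : ℤ) - b.1)).toNat b hb a ha (by omega)
      rw [← Relation.reflTransGen_swap] at this
      refine Relation.ReflTransGen.mono ?_ _ _ this
      intro x y hxy
      exact hsymm hxy
  · rintro ⟨a, b, h1, h2, h3, h4⟩
    have := h1.2.1
    have := h4.1
    simp only at *
    omega

/-- For a core, each runner is a flush. -/
theorem core_runner (n : ℕ) (l : NatPartition) (hcore : IsCore n l) (s : ℤ) :
    ∃ A : ℤ, ∀ k : ℤ, s + ((n : ℤ) + 1) * k ∈ l.beadSet ↔ k < A := by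
  obtain ⟨M, hM⟩ := l.finite_support
  have hdown : ∀ d : ℕ, ∀ k : ℤ, s + ((n : ℤ) + 1) * k ∈ l.beadSet →
      s + ((n : ℤ) + 1) * (k - d) ∈ l.beadSet := by
    intro d
    induction d with
    | zero => intro k h; simpa using h
    | succ d ih =>
      intro k h
      have := core_shift n l hcore _ (ih k h)
      convert this using 1
      push_cast; ring
  obtain ⟨A, hA, hmax⟩ := Int.exists_greatest_of_bdd
    (P := fun k : ℤ => s + ((n : ℤ) + 1) * k ∈ l.beadSet)
    ⟨|s| + l.parts 0, by
      rintro z ⟨i, hi⟩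
      simp only at hi
      have h0 := l.antitone (Nat.zero_le i)
      have h1 := neg_abs_le s
      by_contra hz
      have : 0 ≤ (n : ℤ) * z := by
        have := abs_nonneg s
        apply mul_nonneg <;> omega
      have e : ((n : ℤ) + 1) * z = n * z + z := by ring
      omega⟩
    ⟨-(|s| + M), by
      have h1 := le_abs_self s
      have : 0 ≤ (n : ℤ) * (|s| + M) := by positivity
      have e : ((n : ℤ) + 1) * (-(|s| + M)) = - ((n : ℤ) * (|s| + M)) - (|s| + M) := by ring
      refine ⟨(-(s + ((n : ℤ) + 1) * (-(|s| + M)))).toNat, ?_⟩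
      simp only
      rw [hM _ (by omega)]
      omega⟩
  refine ⟨A + 1, fun k => ⟨fun h => by have := hmax k h; omega, fun h => ?_⟩⟩
  have := hdown (A - k).toNat A hA
  rwa [show A - ((A - k).toNat : ℤ) = k by omega] at this

theorem modEq_param (n : ℕ) (s p : ℤ) :
    p ≡ s [ZMOD ((n : ℤ) + 1)] ↔ ∃ k : ℤ, p = s + ((n : ℤ) + 1) * k := by
  rw [Int.modEq_comm, Int.modEq_iff_dvd]
  constructor
  · rintro ⟨k, hk⟩; exact ⟨k, by linarith⟩
  · rintro ⟨k, hk⟩; exact ⟨k, by linarith⟩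

theorem runner_pos (n : ℕ) (s : ℤ) (h1 : 1 ≤ s) (h2 : s ≤ (n : ℤ) + 1) (k K : ℤ) :
    -(((n : ℤ) + 1) * K) < s + ((n : ℤ) + 1) * k ↔ -K ≤ k := by
  constructor
  · intro h
    by_contra hk
    have : ((n : ℤ) + 1) * (k + K) ≤ ((n : ℤ) + 1) * (-1) :=
      mul_le_mul_of_nonneg_left (by omega) (by omega)
    linarith
  · intro h
    have : 0 ≤ ((n : ℤ) + 1) * (k + K) := mul_nonneg (by omega) (by omega)
    linarith

theorem param_eq (n : ℕ) (l : NatPartition) (s : ℤ) (h1 : 1 ≤ s) (h2 : s ≤ (n : ℤ) + 1) (A : ℤ)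
    (hA : ∀ k : ℤ, s + ((n : ℤ) + 1) * k ∈ l.beadSet ↔ k < A) : abacusParam n s l = A := by
  have hpos : ∀ k : ℤ, 0 < s + ((n : ℤ) + 1) * k ↔ 0 ≤ k := by
    intro k; simpa using runner_pos n s h1 h2 k 0
  have hinj : Function.Injective (fun k : ℤ => s + ((n : ℤ) + 1) * k) := by
    intro a b h
    simp only at h
    exact mul_left_cancel₀ (show (n : ℤ) + 1 ≠ 0 by omega) (by linarith)
  have e1 : {p : ℤ | p ∈ l.beadSet ∧ 0 < p ∧ p ≡ s [ZMOD ((n : ℤ) + 1)]} =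
      (fun k : ℤ => s + ((n : ℤ) + 1) * k) '' (Finset.Ico 0 A : Finset ℤ) := by
    ext p
    simp only [modEq_param, Set.mem_setOf_eq, Set.mem_image, Finset.coe_Ico, Set.mem_Ico]
    constructor
    · rintro ⟨hb, hp, k, rfl⟩
      exact ⟨k, ⟨(hpos k).1 hp, (hA k).1 hb⟩, rfl⟩
    · rintro ⟨k, ⟨ha, hb⟩, rfl⟩
      exact ⟨(hA k).2 hb, (hpos k).2 ha, k, rfl⟩
  have e2 : {p : ℤ | p ≤ 0 ∧ p ∉ l.beadSet ∧ p ≡ s [ZMOD ((n : ℤ) + 1)]} =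
      (fun k : ℤ => s + ((n : ℤ) + 1) * k) '' (Finset.Ico A 0 : Finset ℤ) := by
    ext p
    simp only [modEq_param, Set.mem_setOf_eq, Set.mem_image, Finset.coe_Ico, Set.mem_Ico]
    constructor
    · rintro ⟨hp, hb, k, rfl⟩
      rw [hA] at hb
      have := hpos k
      exact ⟨k, ⟨by omega, by by_contra h; have := this.2 (by omega); omega⟩, rfl⟩
    · rintro ⟨k, ⟨ha, hb⟩, rfl⟩
      have := hpos k
      refine ⟨by by_contra h; have := this.1 (by omega); omega, ?_, k, rfl⟩
      rw [hA]; omega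
  rw [abacusParam, e1, e2, Set.ncard_image_of_injective _ hinj, Set.ncard_image_of_injective _ hinj,
    Set.ncard_coe_finset, Set.ncard_coe_finset, Int.card_Ico, Int.card_Ico]
  omega

/-- Regrouping a sum over beads by runners. -/
theorem regroup (n K : ℕ) (b : ℕ → ℤ) (hb : Function.Injective b) (A : ℕ → ℤ)
    (h : ∀ s : ℕ, 1 ≤ s → s ≤ n + 1 → ∀ k : ℤ,
      (∃ i < (n + 1) * K, b i = s + ((n : ℤ) + 1) * k) ↔ (-(K : ℤ) ≤ k ∧ k < A s)) (f : ℤ → ℚ) :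
    ∑ i ∈ Finset.range ((n + 1) * K), f (b i) =
      ∑ s ∈ Finset.Icc 1 (n + 1), ∑ k ∈ Finset.Ico (-(K : ℤ)) (A s),
        f ((s : ℤ) + ((n : ℤ) + 1) * k) := by
  rw [Finset.sum_sigma']
  symm
  have hx : ∀ x ∈ (Finset.Icc 1 (n + 1)).sigma (fun s => Finset.Ico (-(K : ℤ)) (A s)),
      ∃ i < (n + 1) * K, b i = (x.1 : ℤ) + ((n : ℤ) + 1) * x.2 := by
    rintro ⟨s, k⟩ hx
    simp only [Finset.mem_sigma, Finset.mem_Icc, Finset.mem_Ico] at hx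
    exact (h s hx.1.1 hx.1.2 k).2 hx.2
  choose! g hg using hx
  refine Finset.sum_bij (fun x _ => g x) ?_ ?_ ?_ ?_
  · intro x hx; exact Finset.mem_range.2 (hg x hx).1
  · rintro x hx y hy hxy
    have e1 := (hg x hx).2
    have e2 := (hg y hy).2
    rw [hxy] at e1
    rw [e1] at e2
    obtain ⟨s, k⟩ := x
    obtain ⟨s', k'⟩ := y
    simp only [Finset.mem_sigma, Finset.mem_Icc, Finset.mem_Ico] at hx hy e2
    have hk : k = k' := by
      have r1 := runner_pos n (s : ℤ) (by omega) (by omega) k (-k')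
      have r2 := runner_pos n (s' : ℤ) (by omega) (by omega) k' (-k)
      have t1 : -(((n : ℤ) + 1) * -k') = ((n : ℤ) + 1) * k' := by ring
      have t2 : -(((n : ℤ) + 1) * -k) = ((n : ℤ) + 1) * k := by ring
      rw [t1] at r1
      rw [t2] at r2
      have := r1.1 (by omega)
      have := r2.1 (by omega)
      omega
    subst hk
    have : s = s' := by omega
    rw [this]
  · intro i hi
    have e := Int.emod_add_mul_ediv (b i - 1) ((n : ℤ) + 1)
    have p1 := Int.emod_nonneg (b i - 1) (show (n : ℤ) + 1 ≠ 0 by omega)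
    have p2 := Int.emod_lt_of_pos (b i - 1) (show 0 < (n : ℤ) + 1 by omega)
    have hbi : b i = (((b i - 1) % ((n : ℤ) + 1) + 1).toNat : ℤ) +
      ((n : ℤ) + 1) * ((b i - 1) / ((n : ℤ) + 1)) := by omega
    have hm : (⟨((b i - 1) % ((n : ℤ) + 1) + 1).toNat, (b i - 1) / ((n : ℤ) + 1)⟩ : Σ _ : ℕ, ℤ) ∈
        (Finset.Icc 1 (n + 1)).sigma (fun s => Finset.Ico (-(K : ℤ)) (A s)) := by
      simp only [Finset.mem_sigma, Finset.mem_Icc, Finset.mem_Ico]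
      refine ⟨by omega, ?_⟩
      refine (h _ (by omega) (by omega) _).1 ⟨i, Finset.mem_range.1 hi, hbi⟩
    refine ⟨_, hm, hb ?_⟩
    rw [(hg _ hm).2]
    exact hbi.symm
  · intro x hx
    rw [(hg x hx).2]

theorem sum_lin (K : ℕ) (A : ℤ) (hA : -(K : ℤ) ≤ A) (d : ℚ) :
    ∑ k ∈ Finset.Ico (-(K : ℤ)) A, ((k : ℚ) + 1 + d) =
      (A * (A + 1) / 2 + d * A) - ((-K : ℚ) * (-K + 1) / 2 + d * (-K)) := by
  induction A, hA using Int.le_induction with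
  | base => simp
  | succ m hm ih =>
    rw [← Finset.insert_Ico_right_eq_Ico_add_one hm, Finset.sum_insert (by simp), ih]
    push_cast
    ring

theorem div_uniq (N y t : ℤ) (hN : 0 < N) (h1 : N * t ≤ y) (h2 : y < N * t + N) : y / N = t := by
  apply Int.ediv_eq_iff_of_pos hN |>.2
  constructor <;> linarith

theorem row_count (n r i m : ℕ) :
    (((Finset.range m).filter (fun j : ℕ => (i : ℤ) - j ≡ r [ZMOD ((n : ℤ) + 1)])).card : ℤ) =
      ((m : ℤ) - i + r + n) / ((n : ℤ) + 1) - (-(i : ℤ) + r + n) / ((n : ℤ) + 1) := by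
  induction m with
  | zero => simp
  | succ m ih =>
    rw [Finset.range_add_one, Finset.filter_insert]
    have hN : 0 < (n : ℤ) + 1 := by omega
    have e := Int.emod_add_mul_ediv ((m : ℤ) - i + r) ((n : ℤ) + 1)
    have p1 := Int.emod_nonneg ((m : ℤ) - i + r) (show (n : ℤ) + 1 ≠ 0 by omega)
    have p2 := Int.emod_lt_of_pos ((m : ℤ) - i + r) hN
    have hmod : (i : ℤ) - m ≡ r [ZMOD ((n : ℤ) + 1)] ↔ ((m : ℤ) - i + r) % ((n : ℤ) + 1) = 0 := by
      rw [Int.modEq_iff_dvd, ← Int.dvd_iff_emod_eq_zero]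
      rw [show (r : ℤ) - (i - m) = (m : ℤ) - i + r by ring]
    generalize ((m : ℤ) - i + r) / ((n : ℤ) + 1) = t at *
    generalize ((m : ℤ) - i + r) % ((n : ℤ) + 1) = u at *
    have q1 : (((m + 1 : ℕ) : ℤ) - i + r + n) / ((n : ℤ) + 1) = t + 1 := by
      apply div_uniq _ _ _ hN <;> rw [mul_add] <;> push_cast <;> omega
    rw [q1]
    split_ifs with h
    · rw [hmod] at h
      have q2 : ((m : ℤ) - i + r + n) / ((n : ℤ) + 1) = t := by
        apply div_uniq _ _ _ hN <;> omega
      rw [Finset.card_insert_of_notMem (by simp)]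
      push_cast
      rw [ih, q2]
      ring
    · rw [hmod] at h
      have q2 : ((m : ℤ) - i + r + n) / ((n : ℤ) + 1) = t + 1 := by
        apply div_uniq _ _ _ hN <;> rw [mul_add] <;> omega
      rw [ih, q2]

theorem wt_rows (n r : ℕ) (l : NatPartition) (M : ℕ) (hM : ∀ i, M ≤ i → l.parts i = 0) :
    (NatPartition.wt n (r : ℤ) l : ℤ) = ∑ i ∈ Finset.range M,
      (((l.parts i : ℤ) - i + r + n) / ((n : ℤ) + 1) - (-(i : ℤ) + r + n) / ((n : ℤ) + 1)) := by
  have e : {c : ℕ × ℕ | c ∈ l.diagram ∧ ((c.1 : ℤ) - (c.2 : ℤ)) ≡ r [ZMOD ((n : ℤ) + 1)]} =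
      (((Finset.range M).sigma (fun i => (Finset.range (l.parts i)).filter
        (fun j : ℕ => (i : ℤ) - j ≡ r [ZMOD ((n : ℤ) + 1)]))).map
          (Equiv.sigmaEquivProd ℕ ℕ).toEmbedding : Finset (ℕ × ℕ)) := by
    ext ⟨i, j⟩
    simp only [NatPartition.diagram, Set.mem_setOf_eq, Finset.coe_map, Set.mem_image,
      Finset.mem_coe, Finset.mem_sigma, Finset.mem_range, Finset.mem_filter]
    constructor
    · rintro ⟨h1, h2⟩
      refine ⟨⟨i, j⟩, ⟨?_, h1, h2⟩, rfl⟩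
      by_contra h
      have := hM i (by simpa using h)
      omega
    · rintro ⟨⟨i', j'⟩, ⟨h0, h1, h2⟩, h⟩
      simp only [Equiv.coe_toEmbedding, Equiv.sigmaEquivProd_apply, Prod.mk.injEq] at h
      obtain ⟨rfl, rfl⟩ := h
      exact ⟨h1, h2⟩
  rw [NatPartition.wt, e, Set.ncard_coe_finset, Finset.card_map, Finset.card_sigma]
  push_cast
  exact Finset.sum_congr rfl (fun i _ => row_count n r i (l.parts i))

theorem main_formula (n : ℕ) (lam : NatPartition) (hcore : IsCore n lam) (r : ℕ) (hr : r ≤ n) :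
    (NatPartition.wt n (r : ℤ) lam : ℚ)
      = (1 / 2) * ∑ s ∈ Finset.Icc 1 (n + 1), (abacusParam n (s : ℤ) lam : ℚ) ^ 2
        + ∑ s ∈ Finset.Icc (n + 2 - r) (n + 1), (abacusParam n (s : ℤ) lam : ℚ) := by
  obtain ⟨K, hK⟩ := lam.finite_support
  have hA : ∀ s : ℕ, 1 ≤ s → s ≤ n + 1 → ∀ k : ℤ,
      (s : ℤ) + ((n : ℤ) + 1) * k ∈ lam.beadSet ↔ k < abacusParam n s lam := by
    intro s h1 h2
    obtain ⟨A, hA⟩ := core_runner n lam hcore s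
    rw [param_eq n lam s (by omega) (by omega) A hA]
    exact hA
  set A : ℕ → ℤ := fun s => abacusParam n (s : ℤ) lam with hAd
  have hKM : K ≤ (n + 1) * K := Nat.le_mul_of_pos_left _ (by omega)
  have hM : ∀ i, (n + 1) * K ≤ i → lam.parts i = 0 := fun i hi => hK i (by omega)
  have hcast : (((n + 1) * K : ℕ) : ℤ) = ((n : ℤ) + 1) * K := by push_cast; ring
  have hAK : ∀ s : ℕ, 1 ≤ s → s ≤ n + 1 → -(K : ℤ) ≤ A s := by
    intro s h1 h2
    have := (hA s h1 h2 (-(K : ℤ) - 1)).1 (by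
      have e : ((n : ℤ) + 1) * (-(K : ℤ) - 1) = -(((n + 1) * K : ℕ) : ℤ) - n - 1 := by
        push_cast; ring
      refine ⟨(-((s : ℤ) + ((n : ℤ) + 1) * (-(K : ℤ) - 1))).toNat, ?_⟩
      simp only
      rw [hM _ (by omega)]
      omega)
    simp only [A]
    omega
  have hG : ∀ s : ℕ, 1 ≤ s → s ≤ n + 1 → ∀ k : ℤ,
      ((((s : ℤ) + ((n : ℤ) + 1) * k + r + n) / ((n : ℤ) + 1) : ℤ) : ℚ) =
        (k : ℚ) + 1 + (if n + 2 - r ≤ s then 1 else 0) := by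
    intro s h1 h2 k
    split_ifs with h
    · rw [div_uniq _ _ (k + 1 + 1) (by omega) (by simp only [mul_add]; omega)
        (by simp only [mul_add]; omega)]
      push_cast; ring
    · rw [div_uniq _ _ (k + 1) (by omega) (by simp only [mul_add]; omega)
        (by simp only [mul_add]; omega)]
      push_cast; ring
  have inj1 : Function.Injective (fun i : ℕ => (lam.parts i : ℤ) - i) := by
    intro i j h
    simp only at h
    rcases lt_trichotomy i j with hk | hk | hk
    · have := lam.antitone hk.le; omega
    · exact hk
    · have := lam.antitone hk.le; omega
  have inj0 : Function.Injective (fun i : ℕ => -(i : ℤ)) := by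
    intro i j h
    simp only at h
    omega
  have R1 := regroup n K _ inj1 A (by
    intro s h1 h2 k
    rw [← runner_pos n s (by omega) (by omega) k K, ← hcast]
    constructor
    · rintro ⟨i, hi, hb⟩
      refine ⟨by omega, (hA s h1 h2 k).1 ⟨i, hb⟩⟩
    · rintro ⟨hk, hb⟩
      obtain ⟨i, hi⟩ := (hA s h1 h2 k).2 hb
      refine ⟨i, ?_, hi⟩
      simp only at hi
      by_contra hc
      have := hM i (by omega)
      omega)
  have R0 := regroup n K _ inj0 (fun _ => 0) (by
    intro s h1 h2 k
    rw [← runner_pos n s (by omega) (by omega) k K, ← hcast]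
    have hz := runner_pos n s (by omega) (by omega) k 0
    simp only [mul_zero, neg_zero] at hz
    constructor
    · rintro ⟨i, hi, hb⟩
      refine ⟨by omega, ?_⟩
      by_contra hc
      have := hz.2 (by omega)
      omega
    · rintro ⟨hk, hb⟩
      refine ⟨(-((s : ℤ) + ((n : ℤ) + 1) * k)).toNat, ?_, ?_⟩
      · omega
      · have : ¬ (0 < (s : ℤ) + ((n : ℤ) + 1) * k) := fun h => by have := hz.1 h; omega
        omega)
  have hsum : ∑ s ∈ Finset.Icc 1 (n + 1), (A s : ℚ) = 0 := by
    have h := (R1 (fun _ => 1)).symm.trans (R0 (fun _ => 1))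
    have : ∀ s ∈ Finset.Icc 1 (n + 1), ∑ k ∈ Finset.Ico (-(K : ℤ)) (A s), (1 : ℚ) =
        (A s : ℚ) + K := by
      intro s hs
      rw [Finset.mem_Icc] at hs
      have := hAK s hs.1 hs.2
      rw [Finset.sum_const, Int.card_Ico, nsmul_eq_mul, mul_one]
      have e : (((A s - -(K : ℤ)).toNat : ℤ) : ℚ) = ((A s + K : ℤ) : ℚ) := by
        congr 1; omega
      rw [Int.cast_natCast] at e
      rw [e]; push_cast; ring
    rw [Finset.sum_congr rfl this, Finset.sum_add_distrib] at h
    simpa using h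
  have W := wt_rows n r lam _ hM
  have W' : (NatPartition.wt n (r : ℤ) lam : ℚ) = ((NatPartition.wt n (r : ℤ) lam : ℤ) : ℚ) := by
    simp
  rw [W', W, Finset.sum_sub_distrib]
  push_cast
  have S1 := R1 (fun p => (((p + r + n) / ((n : ℤ) + 1) : ℤ) : ℚ))
  have S0 := R0 (fun p => (((p + r + n) / ((n : ℤ) + 1) : ℤ) : ℚ))
  rw [S1, S0, ← Finset.sum_sub_distrib]
  have T : ∀ s ∈ Finset.Icc 1 (n + 1),
      (∑ k ∈ Finset.Ico (-(K : ℤ)) (A s),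
          ((((s : ℤ) + ((n : ℤ) + 1) * k + r + n) / ((n : ℤ) + 1) : ℤ) : ℚ)) -
        (∑ k ∈ Finset.Ico (-(K : ℤ)) 0,
          ((((s : ℤ) + ((n : ℤ) + 1) * k + r + n) / ((n : ℤ) + 1) : ℤ) : ℚ)) =
      1 / 2 * (A s : ℚ) ^ 2 + 1 / 2 * (A s : ℚ) + (if n + 2 - r ≤ s then (A s : ℚ) else 0) := by
    intro s hs
    rw [Finset.mem_Icc] at hs
    rw [Finset.sum_congr rfl (fun k _ => hG s hs.1 hs.2 k),
      Finset.sum_congr rfl (fun k _ => hG s hs.1 hs.2 k),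
      sum_lin K _ (hAK s hs.1 hs.2), sum_lin K _ (by omega)]
    split_ifs <;> push_cast <;> ring
  rw [Finset.sum_congr rfl T, Finset.sum_add_distrib, Finset.sum_add_distrib, ← Finset.mul_sum,
    ← Finset.mul_sum, hsum, ← Finset.sum_filter]
  have F : (Finset.Icc 1 (n + 1)).filter (fun s => n + 2 - r ≤ s) =
      Finset.Icc (n + 2 - r) (n + 1) := by
    ext s
    simp only [Finset.mem_filter, Finset.mem_Icc]
    omega
  rw [F]
  ring

/-- the weights of an `(n+1)`-core in terms of its abacus parameters. -/
theorem stmt6 (n : ℕ) (hn : 1 ≤ n) (lam : NatPartition) (hcore : IsCore n lam) :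
    ((NatPartition.wt n 0 lam : ℚ)
        = (1 / 2) * ∑ s ∈ Finset.Icc 1 (n + 1), (abacusParam n (s : ℤ) lam : ℚ) ^ 2) ∧
      ∀ r : ℕ, 1 ≤ r → r ≤ n →
        (NatPartition.wt n (r : ℤ) lam : ℚ)
          = (1 / 2) * ∑ s ∈ Finset.Icc 1 (n + 1), (abacusParam n (s : ℤ) lam : ℚ) ^ 2
            + ∑ s ∈ Finset.Icc (n + 2 - r) (n + 1), (abacusParam n (s : ℤ) lam : ℚ) := by
  refine ⟨?_, fun r _ hr => main_formula n lam hcore r hr⟩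
  have h := main_formula n lam hcore 0 (Nat.zero_le n)
  simpa using h
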